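/- arXiv:2208.05166 — 2 statements merged into one kernel-verified Lean document; each statement's English description precedes it below -/
import Mathlib

section
/- Let ρ > 0, let c ≥ 1 be an integer, and let z be a real number with C_{c+1}(−z;ρ) ≠ C_c(−z;ρ). Then the matrix z·I − B^[c] is invertible and, for every 0 ≤ m ≤ c, the m-th component of (z·I − B^[c])^{−1}·e_0 equals C*_m(−z;ρ) − ((C*_{c+1}(−z;ρ) − C*_c(−z;ρ))/(C_{c+1}(−z;ρ) − C_c(−z;ρ))) · C_m(−z;ρ), where e_0 ∈ ℝ^{c+1} is the standard basis vector with first component 1. In particular the (0,0) entry of the resolvent equals −(C*_{c+1}(−z;ρ) − C*_c(−z;ρ))/(C_{c+1}(−z;ρ) − C_c(−z;ρ)). -/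
/-- Charlier polynomials `C_n(x;a)`: `C_0 = 1` and
`a·C_{n+1} + (x−n−a)·C_n + n·C_{n−1} = 0`. -/
noncomputable def charlier (a x : ℝ) : ℕ → ℝ
  | 0 => 1
  | 1 => (a - x) / a
  | n + 2 => (((n : ℝ) + 1 + a - x) * charlier a x (n + 1) - ((n : ℝ) + 1) * charlier a x n) / a

/-- Charlier polynomials of the second kind `C*_n(x;a)`: `C*_0 = 0`, `C*_1 = −1/a`, same
recurrence as `charlier` for `n ≥ 1`. -/
noncomputable def charlierStar (a x : ℝ) : ℕ → ℝ
  | 0 => 0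
  | 1 => -1 / a
  | n + 2 =>
      (((n : ℝ) + 1 + a - x) * charlierStar a x (n + 1) - ((n : ℝ) + 1) * charlierStar a x n) / a

/-- The `(c+1)×(c+1)` generator `B^[c]` of the `M/M/c/c` queue with arrival rate `ρ` and unit
service rate. -/
noncomputable def Bmat (ρ : ℝ) (c : ℕ) : Matrix (Fin (c + 1)) (Fin (c + 1)) ℝ :=
  Matrix.of fun i j =>
    if (i : ℕ) = (j : ℕ) then (if (i : ℕ) = c then -(c : ℝ) else -((i : ℕ) + ρ))
    else if (j : ℕ) = (i : ℕ) + 1 then ρ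
    else if (j : ℕ) + 1 = (i : ℕ) then (i : ℕ)
    else 0

/-- Row `i` of `z • 1 - Bmat ρ c` applied to the restriction of a sequence `u`. -/
theorem sub_Bmat_mulVec_apply (ρ z : ℝ) (c : ℕ) (u : ℕ → ℝ) (i : Fin (c + 1)) :
    (z • (1 : Matrix (Fin (c + 1)) (Fin (c + 1)) ℝ) - Bmat ρ c).mulVec (fun j => u j) i =
      z * u i + (if (i : ℕ) = c then c * u i else (i + ρ) * u i - ρ * u (i + 1)) -
        i * u (i - 1) := by
  obtain ⟨i, hi⟩ := i
  let f : ℕ → ℝ := fun j =>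
    (if i = j then (z + if i = c then (c : ℝ) else i + ρ) * u j else 0) -
      (if i + 1 = j then ρ * u j else 0) - (if i - 1 = j then i * u j else 0)
  have hentry : ∀ j : Fin (c + 1),
      (z • (1 : Matrix (Fin (c + 1)) (Fin (c + 1)) ℝ) - Bmat ρ c) ⟨i, hi⟩ j * u j = f j := by
    rintro ⟨j, hj⟩
    simp only [Matrix.sub_apply, Matrix.smul_apply, Matrix.one_apply, Bmat, Matrix.of_apply,
      Fin.mk.injEq, smul_eq_mul, f]
    rcases Nat.eq_zero_or_pos i with rfl | hpos
    · split_ifs <;> first | omega | (push_cast; ring)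
    · split_ifs <;> first | omega | ring
  simp only [Matrix.mulVec, dotProduct]
  refine (Finset.sum_congr rfl fun j _ => hentry j).trans
    ((Fin.sum_univ_eq_sum_range f (c + 1)).trans ?_)
  simp only [f, Finset.sum_sub_distrib, Finset.sum_ite_eq, Finset.mem_range]
  split_ifs <;> first | omega | ring

theorem charlier_rec {a : ℝ} (ha : a ≠ 0) (x : ℝ) (n : ℕ) :
    a * charlier a x (n + 1) = (n + a - x) * charlier a x n - n * charlier a x (n - 1) := by
  cases n with
  | zero => simp [charlier]; field_simp
  | succ n => simp only [charlier, Nat.add_sub_cancel]; push_cast; field_simp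

theorem charlierStar_rec {a : ℝ} (ha : a ≠ 0) (x : ℝ) (n : ℕ) :
    a * charlierStar a x (n + 1) =
      (n + a - x) * charlierStar a x n - n * charlierStar a x (n - 1) -
        if n = 0 then 1 else 0 := by
  cases n with
  | zero => simp [charlierStar]; field_simp
  | succ n => simp [charlierStar]; field_simp

/-- Off the zeros of `C_{c+1} - C_c`, the matrix `z • 1 - Bmat ρ c` is invertible. -/
theorem isUnit_sub_Bmat {ρ : ℝ} (hρ : ρ ≠ 0) (c : ℕ) {z : ℝ}
    (hz : charlier ρ (-z) (c + 1) ≠ charlier ρ (-z) c) :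
    IsUnit (z • (1 : Matrix (Fin (c + 1)) (Fin (c + 1)) ℝ) - Bmat ρ c) := by
  rw [← Matrix.mulVec_injective_iff_isUnit]
  refine (injective_iff_map_eq_zero (Matrix.mulVecLin _)).2 fun v hv => ?_
  obtain ⟨u, rfl⟩ : ∃ u : ℕ → ℝ, v = fun j : Fin (c + 1) => u j :=
    ⟨fun n => if h : n < c + 1 then v ⟨n, h⟩ else 0, by ext j; simp [j.is_lt]⟩
  have hrow : ∀ i ≤ c, z * u i + (if i = c then c * u i else (i + ρ) * u i - ρ * u (i + 1)) -
      i * u (i - 1) = 0 := fun i hi => by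
    simpa using (sub_Bmat_mulVec_apply ρ z c u ⟨i, by omega⟩).symm.trans (congrFun hv _)
  have hu : ∀ n ≤ c, u n = u 0 * charlier ρ (-z) n := by
    intro n
    induction n using Nat.strong_induction_on with
    | _ n ih =>
      intro hn
      cases n with
      | zero => simp [charlier]
      | succ n =>
        have h := hrow n (by omega)
        rw [if_neg (by omega), ih n (by omega) (by omega), ih (n - 1) (by omega) (by omega)] at h
        apply mul_left_cancel₀ hρ
        linear_combination -h - u 0 * charlier_rec hρ (-z) n
  have hlast := hrow c le_rfl
  rw [if_pos rfl, hu c le_rfl, hu (c - 1) (by omega)] at hlast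
  have hmul : u 0 * (ρ * (charlier ρ (-z) (c + 1) - charlier ρ (-z) c)) = 0 := by
    linear_combination hlast + u 0 * charlier_rec hρ (-z) c
  have hu0 : u 0 = 0 :=
    (mul_eq_zero.1 hmul).resolve_right (mul_ne_zero hρ (sub_ne_zero.2 hz))
  ext j
  simp [hu j (by omega), hu0]

/-- explicit form of the resolvent of `B^[c]` applied to `e_0`. -/
theorem resolvent_Bmat (ρ : ℝ) (hρ : 0 < ρ) (c : ℕ) (hc : 1 ≤ c) (z : ℝ)
    (hz : charlier ρ (-z) (c + 1) ≠ charlier ρ (-z) c) :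
    IsUnit (z • (1 : Matrix (Fin (c + 1)) (Fin (c + 1)) ℝ) - Bmat ρ c) ∧
      (∀ m : Fin (c + 1),
        (z • (1 : Matrix (Fin (c + 1)) (Fin (c + 1)) ℝ) - Bmat ρ c)⁻¹.mulVec
            (fun j => if j = 0 then 1 else 0) m =
          charlierStar ρ (-z) m -
            (charlierStar ρ (-z) (c + 1) - charlierStar ρ (-z) c) /
              (charlier ρ (-z) (c + 1) - charlier ρ (-z) c) * charlier ρ (-z) m) ∧
      (z • (1 : Matrix (Fin (c + 1)) (Fin (c + 1)) ℝ) - Bmat ρ c)⁻¹ 0 0 =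
        -((charlierStar ρ (-z) (c + 1) - charlierStar ρ (-z) c) /
          (charlier ρ (-z) (c + 1) - charlier ρ (-z) c)) := by
  have hρ0 : ρ ≠ 0 := hρ.ne'
  have hunit := isUnit_sub_Bmat hρ0 c hz
  set A := z • (1 : Matrix (Fin (c + 1)) (Fin (c + 1)) ℝ) - Bmat ρ c with hA
  set r := (charlierStar ρ (-z) (c + 1) - charlierStar ρ (-z) c) /
    (charlier ρ (-z) (c + 1) - charlier ρ (-z) c) with hr
  have hr_mul : r * (charlier ρ (-z) (c + 1) - charlier ρ (-z) c) =
      charlierStar ρ (-z) (c + 1) - charlierStar ρ (-z) c :=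
    div_mul_cancel₀ _ (sub_ne_zero.2 hz)
  have hsol : A.mulVec (fun j => charlierStar ρ (-z) j - r * charlier ρ (-z) j) =
      fun j => if j = 0 then 1 else 0 := by
    ext i
    rw [hA, sub_Bmat_mulVec_apply ρ z c
      (fun n => charlierStar ρ (-z) n - r * charlier ρ (-z) n)]
    have hC := charlier_rec hρ0 (-z) i
    have hS := charlierStar_rec hρ0 (-z) i
    have hi : i = 0 ↔ (i : ℕ) = 0 := Fin.ext_iff
    simp only [hi]
    by_cases hic : (i : ℕ) = c
    · rw [if_pos hic]
      rw [hic] at hC hS ⊢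
      linear_combination r * hC - hS - ρ * hr_mul
    · rw [if_neg hic]
      linear_combination r * hC - hS
  have hinv : A⁻¹.mulVec (fun j => if j = 0 then 1 else 0) =
      fun j : Fin (c + 1) => charlierStar ρ (-z) j - r * charlier ρ (-z) j := by
    rw [← hsol, Matrix.mulVec_mulVec,
      Matrix.nonsing_inv_mul _ ((Matrix.isUnit_iff_isUnit_det A).1 hunit), Matrix.one_mulVec]
  refine ⟨hunit, congrFun hinv, ?_⟩
  simpa [Matrix.mulVec, dotProduct, charlier, charlierStar] using congrFun hinv 0
end

section
/- Let ρ > 0, σ > 0 and let c ≥ 1 be an integer, and assume C_{c+1}(−σ;ρ) ≠ C_c(−σ;ρ). Then the matrix I − A^[c](σ) is invertible and, for every 0 ≤ m ≤ c, letting w_m = σ/(m+σ+ρ) if m < c and w_c = σ/(σ+c), one has w_m · ((I − A^[c](σ))^{−1})_{0,m} = σ · (ρ^m/m!) · ( C*_m(−σ;ρ) − ((C*_{c+1}(−σ;ρ) − C*_c(−σ;ρ))/(C_{c+1}(−σ;ρ) − C_c(−σ;ρ))) · C_m(−σ;ρ) ). (The left-hand side is the probability that the M/M/c/c queue, initially empty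 and observed during an exp(σ)-distributed period, contains exactly m customers when the observer leaves.) -/
/-- The `(c+1)×(c+1)` substochastic transition matrix `A^[c](σ)` of the absorbed chain of the
`M/M/c/c` queue. -/
noncomputable def Amat (ρ σ : ℝ) (c : ℕ) : Matrix (Fin (c + 1)) (Fin (c + 1)) ℝ :=
  Matrix.of fun i j =>
    if (j : ℕ) = (i : ℕ) + 1 then ρ / ((i : ℕ) + σ + ρ)
    else if (j : ℕ) + 1 = (i : ℕ) then
      (if (i : ℕ) = c then (c : ℝ) / ((c : ℝ) + σ) else (i : ℕ) / ((i : ℕ) + σ + ρ))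
    else 0

theorem sum_fin_ite_val_eq (n k : ℕ) (f : ℕ → ℝ) :
    ∑ i : Fin n, (if (i : ℕ) = k then f i else 0) = if k < n then f k else 0 := by
  rw [Fin.sum_univ_eq_sum_range (fun i => if i = k then f i else 0) n, Finset.sum_ite_eq']
  simp

theorem sum_fin_ite_val_succ_eq (n k : ℕ) (hk : k < n) (f : ℕ → ℝ) :
    ∑ i : Fin n, (if (i : ℕ) + 1 = k then f i else 0) = if k = 0 then 0 else f (k - 1) := by
  rcases k with _ | k
  · simp
  · have := sum_fin_ite_val_eq n k f
    rw [if_pos (by omega)] at this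
    simpa using this

theorem charlier_recurrence {a : ℝ} (ha : a ≠ 0) (x : ℝ) (n : ℕ) :
    a * charlier a x (n + 2) =
      ((n : ℝ) + 1 + a - x) * charlier a x (n + 1) - ((n : ℝ) + 1) * charlier a x n := by
  rw [charlier]
  field_simp

theorem charlierStar_recurrence {a : ℝ} (ha : a ≠ 0) (x : ℝ) (n : ℕ) :
    a * charlierStar a x (n + 2) =
      ((n : ℝ) + 1 + a - x) * charlierStar a x (n + 1) - ((n : ℝ) + 1) * charlierStar a x n := by
  rw [charlierStar]
  field_simp

/-- The matrix `I - A^[c](σ)` is strictly diagonally dominant, hence invertible. -/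
theorem det_one_sub_Amat_ne_zero {ρ σ : ℝ} (hρ : 0 < ρ) (hσ : 0 < σ) (c : ℕ) :
    ((1 : Matrix (Fin (c + 1)) (Fin (c + 1)) ℝ) - Amat ρ σ c).det ≠ 0 := by
  apply det_ne_zero_of_sum_row_lt_diag
  intro k
  have hk := k.isLt
  have hk0 : (0 : ℝ) ≤ (k : ℕ) := Nat.cast_nonneg _
  have hdiag : ((1 : Matrix (Fin (c + 1)) (Fin (c + 1)) ℝ) - Amat ρ σ c) k k = 1 := by
    simp [Amat]
  have hnonneg : ∀ j, 0 ≤ Amat ρ σ c k j := by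
    intro j
    simp only [Amat, Matrix.of_apply]
    split_ifs <;> positivity
  have hoff : ∀ j ∈ Finset.univ.erase k,
      ‖((1 : Matrix (Fin (c + 1)) (Fin (c + 1)) ℝ) - Amat ρ σ c) k j‖ = Amat ρ σ c k j := by
    intro j hj
    have hjk : k ≠ j := (Finset.ne_of_mem_erase hj).symm
    rw [Matrix.sub_apply, Matrix.one_apply_ne hjk, zero_sub, norm_neg, Real.norm_eq_abs,
      abs_of_nonneg (hnonneg j)]
  rw [hdiag, norm_one, Finset.sum_congr rfl hoff]
  refine (Finset.sum_le_sum_of_subset_of_nonneg (Finset.erase_subset _ _)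
    fun j _ _ => hnonneg j).trans_lt ?_
  set b : ℝ := if (k : ℕ) = c then (c : ℝ) / ((c : ℝ) + σ) else (k : ℕ) / ((k : ℕ) + σ + ρ)
    with hb
  have hsplit : ∀ j : Fin (c + 1), Amat ρ σ c k j =
      (if (j : ℕ) = k + 1 then ρ / ((k : ℕ) + σ + ρ) else 0) +
        (if (j : ℕ) + 1 = k then b else 0) := by
    intro j
    simp only [Amat, Matrix.of_apply, ← hb]
    by_cases h₁ : (j : ℕ) = k + 1
    · rw [if_pos h₁, if_pos h₁, if_neg (by omega), add_zero]
    · rw [if_neg h₁, if_neg h₁, zero_add]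
  simp only [hsplit, Finset.sum_add_distrib]
  rw [sum_fin_ite_val_eq (c + 1) (k + 1) fun _ => ρ / ((k : ℕ) + σ + ρ),
    sum_fin_ite_val_succ_eq (c + 1) k hk fun _ => b]
  have hb0 : (if (k : ℕ) = 0 then 0 else b) ≤ b := by
    split_ifs
    · rw [hb]; split_ifs <;> positivity
    · exact le_rfl
  by_cases hkc : (k : ℕ) = c
  · rw [if_neg (by omega), zero_add]
    refine hb0.trans_lt ?_
    rw [hb, if_pos hkc, div_lt_one (by positivity)]
    linarith
  · rw [if_pos (by omega)]
    refine (add_le_add_right hb0 _).trans_lt ?_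
    rw [hb, if_neg hkc, ← add_div, div_lt_one (by positivity)]
    linarith

/-- The flow balance equations of the queue, read as a row-vector equation for `I - A^[c](σ)`. -/
theorem vecMul_one_sub_Amat {ρ σ : ℝ} (hρ : 0 < ρ) (hσ : 0 < σ) (c : ℕ) (q : ℕ → ℝ)
    (j : Fin (c + 1)) :
    Matrix.vecMul (fun i : Fin (c + 1) => (if (i : ℕ) = c then σ + c else (i : ℕ) + σ + ρ) * q i)
        ((1 : Matrix (Fin (c + 1)) (Fin (c + 1)) ℝ) - Amat ρ σ c) j =
      (if (j : ℕ) = c then σ + c else (j : ℕ) + σ + ρ) * q j -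
        ((if (j : ℕ) = 0 then 0 else ρ * q (j - 1)) +
          (if (j : ℕ) + 1 < c + 1 then (((j : ℕ) + 1 : ℕ) : ℝ) * q (j + 1) else 0)) := by
  have hj := j.isLt
  rw [Matrix.vecMul_sub, Matrix.vecMul_one, Pi.sub_apply]
  congr 1
  rw [← sum_fin_ite_val_succ_eq (c + 1) j hj fun i => ρ * q i,
    ← sum_fin_ite_val_eq (c + 1) (j + 1) fun i => (i : ℝ) * q i, ← Finset.sum_add_distrib]
  rw [Matrix.vecMul, dotProduct]
  refine Finset.sum_congr rfl fun i _ => ?_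
  have hi : (0 : ℝ) ≤ (i : ℕ) := Nat.cast_nonneg _
  have hne : ((i : ℕ) : ℝ) + σ + ρ ≠ 0 := by positivity
  simp only [Amat, Matrix.of_apply]
  by_cases h₁ : (j : ℕ) = i + 1
  · rw [if_pos h₁, if_pos h₁.symm, if_neg (by omega), if_neg (by omega)]
    field_simp
    ring
  · rw [if_neg h₁, if_neg (Ne.symm h₁), zero_add]
    by_cases h₂ : (j : ℕ) + 1 = i
    · rw [if_pos h₂, if_pos h₂.symm]
      split_ifs with h₃
      · rw [h₃]
        field_simp
        ring
      · field_simp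
    · rw [if_neg h₂, if_neg (Ne.symm h₂), mul_zero]


/-- the distribution of the number `ν^[c](σ)` of customers present in the
initially empty `M/M/c/c` queue when an `exp(σ)`-observer leaves, via Charlier polynomials. -/
theorem prob_nu_mmcc (ρ σ : ℝ) (hρ : 0 < ρ) (hσ : 0 < σ) (c : ℕ) (hc : 1 ≤ c)
    (hne : charlier ρ (-σ) (c + 1) ≠ charlier ρ (-σ) c) :
    IsUnit ((1 : Matrix (Fin (c + 1)) (Fin (c + 1)) ℝ) - Amat ρ σ c) ∧
      ∀ m : Fin (c + 1),
        (if (m : ℕ) = c then σ / (σ + c) else σ / ((m : ℕ) + σ + ρ)) *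
            ((1 : Matrix (Fin (c + 1)) (Fin (c + 1)) ℝ) - Amat ρ σ c)⁻¹ 0 m =
          σ * (ρ ^ (m : ℕ) / (m : ℕ).factorial) *
            (charlierStar ρ (-σ) m -
              (charlierStar ρ (-σ) (c + 1) - charlierStar ρ (-σ) c) /
                (charlier ρ (-σ) (c + 1) - charlier ρ (-σ) c) * charlier ρ (-σ) m) := by
  set M := (1 : Matrix (Fin (c + 1)) (Fin (c + 1)) ℝ) - Amat ρ σ c with hM
  have hρ0 := hρ.ne'
  have hdet : IsUnit M.det := (det_one_sub_Amat_ne_zero hρ hσ c).isUnit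
  refine ⟨(Matrix.isUnit_iff_isUnit_det _).2 hdet, fun m => ?_⟩
  set K := (charlierStar ρ (-σ) (c + 1) - charlierStar ρ (-σ) c) /
    (charlier ρ (-σ) (c + 1) - charlier ρ (-σ) c) with hK
  set y : ℕ → ℝ := fun n => charlierStar ρ (-σ) n - K * charlier ρ (-σ) n with hy
  have hy_zero : ρ * y 1 = (σ + ρ) * y 0 - 1 := by
    simp only [hy, charlier, charlierStar]
    field_simp
    ring
  have hy_succ : ∀ n : ℕ, ρ * y (n + 2) = ((n : ℝ) + 1 + ρ + σ) * y (n + 1) - (n + 1) * y n := by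
    intro n
    simp only [hy]
    linear_combination charlierStar_recurrence hρ0 (-σ) n - K * charlier_recurrence hρ0 (-σ) n
  have hy_top : y (c + 1) = y c := by
    have h := div_mul_cancel₀ (charlierStar ρ (-σ) (c + 1) - charlierStar ρ (-σ) c)
      (sub_ne_zero.2 hne)
    rw [← hK] at h
    simp only [hy]
    linear_combination -h
  set q : ℕ → ℝ := fun n => ρ ^ n / n.factorial * y n with hq
  have hsolve : Matrix.vecMul
      (fun i : Fin (c + 1) => (if (i : ℕ) = c then σ + c else (i : ℕ) + σ + ρ) * q i) M =
      Pi.single 0 1 := by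
    ext j
    rw [hM, vecMul_one_sub_Amat hρ hσ]
    obtain ⟨j, hj⟩ := j
    rcases j with _ | n
    · refine Eq.trans ?_ (Pi.single_eq_same (M := fun _ => ℝ) (0 : Fin (c + 1)) 1).symm
      simp only [hq]
      rw [if_neg (show ¬0 = c by omega), if_pos (show 0 + 1 < c + 1 by omega)]
      simp only [Nat.factorial_zero, Nat.factorial_one, Nat.cast_zero, Nat.cast_one, zero_add,
        pow_zero, pow_one, div_one, one_mul, if_true]
      linear_combination -hy_zero
    · have hne0 : (⟨n + 1, hj⟩ : Fin (c + 1)) ≠ 0 := by simp [Fin.ext_iff]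
      have hn1 : (n : ℝ) + 1 ≠ 0 := by positivity
      have hn2 : (n : ℝ) + 1 + 1 ≠ 0 := by positivity
      have hnf : (n.factorial : ℝ) ≠ 0 := by positivity
      rw [Pi.single_eq_of_ne hne0]
      simp only [hq, Nat.add_sub_cancel]
      rw [if_neg (Nat.succ_ne_zero n)]
      have hrec := hy_succ n
      by_cases hnc : n + 1 = c
      · rw [if_pos hnc, if_neg (by omega)]
        subst hnc
        rw [show n + 2 = n + 1 + 1 from rfl, hy_top] at hrec
        push_cast [Nat.factorial_succ]
        field_simp
        linear_combination -ρ ^ (n + 1) * hrec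
      · rw [if_neg hnc, if_pos (by omega)]
        push_cast [Nat.factorial_succ]
        field_simp
        linear_combination -ρ ^ (n + 1) * hrec
  have hinv : (fun i : Fin (c + 1) => (if (i : ℕ) = c then σ + c else (i : ℕ) + σ + ρ) * q i) =
      M⁻¹ 0 := by
    have h := congrArg (fun v => Matrix.vecMul v M⁻¹) hsolve
    change _ = M⁻¹.row 0
    simpa [Matrix.vecMul_vecMul, Matrix.mul_nonsing_inv M hdet] using h
  rw [← hinv]
  have hm : (0 : ℝ) ≤ (m : ℕ) := Nat.cast_nonneg _
  simp only [hq, hy]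
  split_ifs <;> field_simp
end
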